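/- arXiv:math/0211291 — 3 statements merged into one kernel-verified Lean document; each statement's English description precedes it below -/
import Mathlib

section
/- (Stechkin) For h = 1/q with q = 2, 3, 4, …, one has A(1/q) = 1/q, and the extremal function is the 1-periodic function equal to max{1 − q|x|, 0} on [−1/2, 1/2]. -/
open Real

/-- Membership in the Turán class `K(h)`, encoded via the nonnegative Fourier cosine
coefficient sequence `a` of a continuous 1-periodic even function
`f(x) = ∑' n, a n * cos (2πnx)`: all `a n ≥ 0`, `∑ a n = 1` (so `f 0 = 1`), and
`f x = 0` for `h ≤ |x| ≤ 1/2`. -/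
def memK (h : ℝ) (a : ℕ → ℝ) : Prop :=
  (∀ n, 0 ≤ a n) ∧ Summable a ∧ (∑' n, a n) = 1 ∧
    ∀ x : ℝ, h ≤ |x| → |x| ≤ 1 / 2 → (∑' n : ℕ, a n * Real.cos (2 * π * n * x)) = 0

/-- The Turán constant `A(h) = sup_{f ∈ K(h)} a₀`. -/
noncomputable def turanA (h : ℝ) : ℝ :=
  sSup {y : ℝ | ∃ a : ℕ → ℝ, memK h a ∧ y = a 0}

open Finset in
lemma sum_cos_two_pi_mul_div_nonneg {q : ℕ} (hq : q ≠ 0) (n : ℕ) :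
    0 ≤ ∑ k ∈ range q, Real.cos (2 * π * n * (k / q)) := by
  set w : ℂ := Complex.exp ((2 * π * n / q : ℝ) * Complex.I) with hw
  have hwq : w ^ q = 1 := by
    rw [hw, ← Complex.exp_nat_mul, Complex.exp_eq_one_iff]
    refine ⟨n, ?_⟩
    push_cast
    field_simp
  have hre : ∑ k ∈ range q, Real.cos (2 * π * n * (k / q)) = (∑ k ∈ range q, w ^ k).re := by
    rw [Complex.re_sum]
    refine sum_congr rfl fun k _ => ?_
    rw [hw, ← Complex.exp_nat_mul, ← Complex.exp_ofReal_mul_I_re]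
    congr 2
    push_cast
    ring
  rw [hre]
  rcases eq_or_ne w 1 with h1 | h1
  · simp [h1]
  · simp [geom_sum_eq h1, hwq]

lemma summable_mul_cos {a : ℕ → ℝ} (h0 : ∀ n, 0 ≤ a n) (ha : Summable a) (x : ℝ) :
    Summable fun n : ℕ => a n * Real.cos (2 * π * n * x) := by
  refine Summable.of_norm_bounded ha fun n => ?_
  rw [norm_mul, Real.norm_of_nonneg (h0 n)]
  exact mul_le_of_le_one_right (h0 n) (Real.abs_cos_le_one _)

lemma memK.tsum_div_eq_zero {q : ℕ} {a : ℕ → ℝ} (ha : memK (1 / q) a) {k : ℕ}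
    (hk : k ≠ 0) (hkq : k < q) :
    ∑' n : ℕ, a n * Real.cos (2 * π * n * (k / q)) = 0 := by
  have hq : (0 : ℝ) < q := by exact_mod_cast (by omega : 0 < q)
  have hk1 : (1 : ℝ) ≤ k := by exact_mod_cast Nat.one_le_iff_ne_zero.mpr hk
  have hk2 : (k : ℝ) + 1 ≤ q := by exact_mod_cast hkq
  have h1 : (1 : ℝ) / q ≤ k / q := by gcongr
  have h2 : (k : ℝ) / q + 1 / q ≤ 1 := by rw [← add_div, div_le_one hq]; exact hk2
  have hpos : (0 : ℝ) < 1 / q := by positivity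
  rcases le_total ((k : ℝ) / q) (1 / 2) with h | h
  · exact ha.2.2.2 _ (by rwa [abs_of_nonneg (by linarith)])
      (by rwa [abs_of_nonneg (by linarith)])
  · have habs : |(k : ℝ) / q - 1| = 1 - k / q := by rw [abs_of_nonpos (by linarith)]; ring
    rw [← ha.2.2.2 ((k : ℝ) / q - 1) (by rw [habs]; linarith) (by rw [habs]; linarith)]
    refine tsum_congr fun n => ?_
    rw [← Real.cos_sub_nat_mul_two_pi _ n]
    ring_nf

open Finset in
lemma memK.zero_le_one_div {q : ℕ} (hq : q ≠ 0) {a : ℕ → ℝ} (ha : memK (1 / q) a) :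
    a 0 ≤ 1 / q := by
  have hs := summable_mul_cos ha.1 ha.2.1
  have hsum : HasSum (fun n : ℕ => a n * ∑ k ∈ range q, Real.cos (2 * π * n * (k / q))) 1 := by
    have h := hasSum_sum fun k (_ : k ∈ range q) => (hs ((k : ℝ) / q)).hasSum
    have h1 : ∑ k ∈ range q, ∑' n : ℕ, a n * Real.cos (2 * π * n * ((k : ℝ) / q)) = 1 := by
      rw [sum_eq_single_of_mem 0 (mem_range.mpr (Nat.pos_of_ne_zero hq))
        fun k hk hk0 => ha.tsum_div_eq_zero hk0 (mem_range.mp hk)]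
      simpa using ha.2.2.1
    rw [h1] at h
    simpa only [mul_sum] using h
  have h0 := le_hasSum hsum 0 fun n _ =>
    mul_nonneg (ha.1 n) (sum_cos_two_pi_mul_div_nonneg hq n)
  rw [le_div_iff₀ (by positivity)]
  simpa using h0

lemma hasSum_one_div_sq_mul_cos {x : ℝ} (hx : |x| ≤ 1) :
    HasSum (fun n : ℕ => 1 / (n : ℝ) ^ 2 * Real.cos (2 * π * n * x))
      (π ^ 2 * (x ^ 2 - |x| + 1 / 6)) := by
  have h := hasSum_one_div_nat_pow_mul_cos (k := 1) one_ne_zero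
    (Set.mem_Icc.mpr ⟨abs_nonneg x, hx⟩)
  have hB : (Polynomial.map (algebraMap ℚ ℝ) (Polynomial.bernoulli 2)).eval |x|
      = x ^ 2 - |x| + 1 / 6 := by
    rw [← sq_abs x]
    simp [Polynomial.bernoulli, Finset.sum_range_succ, bernoulli_two, bernoulli_one]
    ring
  rw [mul_one, hB] at h
  convert h using 1
  · ext n
    rcases abs_choice x with h | h <;> rw [h]
    rw [mul_neg, Real.cos_neg]
  · rw [Nat.factorial_two]
    push_cast
    ring

/-- The cosine coefficients of the `1`-periodic function equal to `max (1 - q|x|) 0` on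
`[-1/2, 1/2]`. -/
noncomputable def triangleCoeff (q n : ℕ) : ℝ :=
  (if n = 0 then 1 / (q : ℝ) else 0) +
    q / π ^ 2 * (1 / (n : ℝ) ^ 2 * (1 - Real.cos (2 * π * n * (1 / q))))

lemma triangleCoeff_nonneg (q n : ℕ) : 0 ≤ triangleCoeff q n := by
  have := Real.cos_le_one (2 * π * n * (1 / q))
  refine add_nonneg (by split_ifs <;> positivity)
    (mul_nonneg (by positivity) (mul_nonneg (by positivity) (by linarith)))

lemma triangleCoeff_zero (q : ℕ) : triangleCoeff q 0 = 1 / q := by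
  simp [triangleCoeff]

lemma hasSum_triangleCoeff_mul_cos {q : ℕ} (hq : 2 ≤ q) {x : ℝ} (hx : |x| ≤ 1 / 2) :
    HasSum (fun n : ℕ => triangleCoeff q n * Real.cos (2 * π * n * x))
      (max (1 - q * |x|) 0) := by
  wlog hx0 : 0 ≤ x generalizing x
  · simpa using this (x := -x) (by rwa [abs_neg]) (by linarith)
  rw [abs_of_nonneg hx0] at hx ⊢
  have hq0 : (0 : ℝ) < q := by exact_mod_cast (by omega : 0 < q)
  set h : ℝ := 1 / q with hh
  have hqh : q * h = 1 := by rw [hh]; field_simp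
  have hpos : 0 < h := by positivity
  have hle : h ≤ 1 / 2 := by
    rw [hh]
    exact one_div_le_one_div_of_le two_pos (by exact_mod_cast hq)
  have hsub : |x - h| ≤ 1 := abs_le.mpr ⟨by linarith, by linarith⟩
  have hadd : |x + h| ≤ 1 := abs_le.mpr ⟨by linarith, by linarith⟩
  have hx1 : |x| ≤ 1 := abs_le.mpr ⟨by linarith, by linarith⟩
  have H := (hasSum_ite_eq 0 h).add
    (((hasSum_one_div_sq_mul_cos hx1).sub
      (((hasSum_one_div_sq_mul_cos hadd).add (hasSum_one_div_sq_mul_cos hsub)).div_const 2)).mul_left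
        (q / π ^ 2))
  convert H using 1
  · ext n
    rw [triangleCoeff, mul_add (2 * π * n), mul_sub (2 * π * n),
      Real.cos_add, Real.cos_sub]
    split_ifs with hn
    · simp [hn, hh]
    · ring
  · rw [abs_of_nonneg hx0, abs_of_nonneg (by linarith : 0 ≤ x + h)]
    have hval : h + q / π ^ 2 * (π ^ 2 * (x ^ 2 - x + 1 / 6) -
        (π ^ 2 * ((x + h) ^ 2 - (x + h) + 1 / 6) + π ^ 2 * ((x - h) ^ 2 - |x - h| + 1 / 6)) / 2)
        = q * (h - x + |x - h|) / 2 + h * (1 - q * h) := by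
      field_simp
      ring
    rw [hval, hqh]
    rcases le_total x h with hxh | hxh
    · rw [abs_of_nonpos (by linarith), max_eq_left (by nlinarith)]
      linear_combination -hqh
    · rw [abs_of_nonneg (by linarith), max_eq_right (by nlinarith)]
      ring

lemma memK_triangleCoeff {q : ℕ} (hq : 2 ≤ q) : memK (1 / q) (triangleCoeff q) := by
  have h0 : HasSum (triangleCoeff q) 1 := by
    simpa using hasSum_triangleCoeff_mul_cos hq (x := 0) (by simp)
  refine ⟨triangleCoeff_nonneg q, h0.summable, h0.tsum_eq, fun x hx hx' => ?_⟩
  have hq0 : (0 : ℝ) < q := by exact_mod_cast (by omega : 0 < q)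
  rw [(hasSum_triangleCoeff_mul_cos hq hx').tsum_eq, max_eq_right]
  rw [div_le_iff₀' hq0] at hx
  linarith

/-- Stechkin's theorem: for `h = 1/q`, `q = 2, 3, …`, one has `A(1/q) = 1/q`, and the
supremum is attained at the 1-periodic function equal to `max (1 - q|x|) 0` on
`[-1/2, 1/2]`. -/
theorem turanA_one_div (q : ℕ) (hq : 2 ≤ q) :
    turanA (1 / q) = 1 / q ∧
    ∃ a : ℕ → ℝ, memK (1 / q) a ∧ a 0 = 1 / q ∧
      ∀ x : ℝ, |x| ≤ 1 / 2 →
        (∑' n : ℕ, a n * Real.cos (2 * π * n * x)) = max (1 - q * |x|) 0 := by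
  refine ⟨IsGreatest.csSup_eq ⟨⟨triangleCoeff q, memK_triangleCoeff hq,
    (triangleCoeff_zero q).symm⟩, ?_⟩, triangleCoeff q, memK_triangleCoeff hq,
    triangleCoeff_zero q, fun x hx => (hasSum_triangleCoeff_mul_cos hq hx).tsum_eq⟩
  rintro _ ⟨a, ha, rfl⟩
  exact ha.zero_le_one_div (by omega)
end

section
/- (Theorem 4) For every integer p ≥ 1 and h = p/(2p+1), A(p/(2p+1)) = cos(π/(2p+1)) / (1 + cos(π/(2p+1))). -/
open Real

theorem cos_pi_mul_odd_div_le {N : ℕ} (hN : 0 < N) {u : ℤ} (hu : Odd u) :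
    Real.cos (π * u / N) ≤ Real.cos (π / N) := by
  have hN0 : (0 : ℝ) < N := by exact_mod_cast hN
  have hred : ∃ v : ℤ, 1 ≤ v ∧ v ≤ N ∧ Real.cos (π * u / N) = Real.cos (π * v / N) := by
    have hdiv := Int.emod_add_mul_ediv u (2 * N)
    have h0 := Int.emod_nonneg u (show (2 * N : ℤ) ≠ 0 by omega)
    have h1 := Int.emod_lt_of_pos u (show (0 : ℤ) < 2 * N by omega)
    set r := u % (2 * N)
    set q := u / (2 * N)
    have hr : r ≠ 0 := by
      intro h
      obtain ⟨k, hk⟩ := hu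
      have h2 : (2 : ℤ) * (N * q - k) = 1 := by rw [h] at hdiv; linarith
      omega
    have hur : (u : ℝ) = r + 2 * N * q := by exact_mod_cast hdiv.symm
    have hcos : Real.cos (π * u / N) = Real.cos (π * r / N) := by
      rw [← Real.cos_add_int_mul_two_pi (π * r / N) q, hur]
      congr 1
      field_simp
    by_cases hle : r ≤ N
    · exact ⟨r, by omega, hle, hcos⟩
    · refine ⟨2 * N - r, by omega, by omega, ?_⟩
      rw [hcos, ← Real.cos_two_pi_sub]
      congr 1
      push_cast
      field_simp
  obtain ⟨v, hv1, hvN, hv⟩ := hred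
  have hv1' : (1 : ℝ) ≤ v := by exact_mod_cast hv1
  have hvN' : (v : ℝ) ≤ N := by exact_mod_cast hvN
  rw [hv]
  apply Real.cos_le_cos_of_nonneg_of_le_pi (by positivity)
  · rw [div_le_iff₀ hN0]
    exact mul_le_mul_of_nonneg_left hvN' pi_pos.le
  · gcongr
    nlinarith [pi_pos]

theorem sum_range_cos_add_two_pi_mul_div {N : ℕ} (hN : 0 < N) (m : ℤ) (θ : ℝ) :
    ∑ i ∈ Finset.range N, Real.cos (θ + 2 * π * m * i / N) =
      if (N : ℤ) ∣ m then N * Real.cos θ else 0 := by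
  have hN0 : (N : ℝ) ≠ 0 := by positivity
  split_ifs with h
  · obtain ⟨k, rfl⟩ := h
    rw [Finset.sum_congr rfl (g := fun _ => Real.cos θ)]
    · simp
    · intro i _
      rw [← Real.cos_add_int_mul_two_pi θ (k * i)]
      congr 1
      push_cast
      field_simp
  · have hsin : Real.sin (π * m / N) ≠ 0 := by
      rw [Ne, Real.sin_eq_zero_iff]
      rintro ⟨k, hk⟩
      apply h
      refine ⟨k, ?_⟩
      field_simp at hk
      have : (m : ℝ) = N * k := by linarith
      exact_mod_cast this
    have htel := Finset.sum_range_sub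
      (fun i : ℕ => Real.sin (θ + (2 * i - 1) * (π * m / N))) N
    have hper : Real.sin (θ + (2 * N - 1) * (π * m / N)) =
        Real.sin (θ + (2 * (0 : ℕ) - 1) * (π * m / N)) := by
      rw [← Real.sin_add_int_mul_two_pi (θ + (2 * (0 : ℕ) - 1) * (π * m / N)) m]
      congr 1
      push_cast
      field_simp
      ring
    simp only [hper, sub_self] at htel
    have hmul : 2 * Real.sin (π * m / N) *
        ∑ i ∈ Finset.range N, Real.cos (θ + 2 * π * m * i / N) = 0 := by
      rw [← htel, Finset.mul_sum]
      refine Finset.sum_congr rfl fun i _ => ?_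
      rw [Real.sin_sub_sin]
      congr 2
      · congr 1
        push_cast
        ring
      · push_cast
        ring
    simpa [hsin] using hmul

theorem hasSum_cos_div_sq {x : ℝ} (h0 : 0 ≤ x) (h1 : x ≤ 1) :
    HasSum (fun n : ℕ => 1 / (n : ℝ) ^ 2 * Real.cos (2 * π * n * x))
      (π ^ 2 * (x ^ 2 - x + 1 / 6)) := by
  have h := hasSum_one_div_nat_pow_mul_cos one_ne_zero (x := x) ⟨h0, h1⟩
  convert! h using 1
  simp [Polynomial.bernoulli, Finset.sum_range_succ, Polynomial.eval_add, bernoulli_two,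
    Nat.factorial]
  ring

/-- The number of signs `±1` with `n ≡ ±1` modulo `N`. -/
noncomputable def unitResidueCount (N n : ℕ) : ℝ :=
  (if (N : ℤ) ∣ n + 1 then 1 else 0) + (if (N : ℤ) ∣ n - 1 then 1 else 0)

theorem unitResidueCount_nonneg (N n : ℕ) : 0 ≤ unitResidueCount N n := by
  unfold unitResidueCount
  positivity

theorem unitResidueCount_mul_cos {N : ℕ} (hN : 0 < N) (p n : ℕ) (x : ℝ) :
    2 / N * ∑ i ∈ Finset.range N, Real.cos (2 * π * (i - p) / N) *
      Real.cos (2 * π * n * (x + (i - p) / N)) =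
    unitResidueCount N n * Real.cos (2 * π * n * x) := by
  have hN0 : (N : ℝ) ≠ 0 := by positivity
  have hprod : ∀ i ∈ Finset.range N, Real.cos (2 * π * (i - p) / N) *
      Real.cos (2 * π * n * (x + (i - p) / N)) =
      (Real.cos ((2 * π * n * x - 2 * π * (n + 1 : ℤ) * p / N) + 2 * π * (n + 1 : ℤ) * i / N) +
       Real.cos ((2 * π * n * x - 2 * π * (n - 1 : ℤ) * p / N) +
        2 * π * (n - 1 : ℤ) * i / N)) / 2 := by
    intro i _
    rw [Real.cos_add_cos, eq_div_iff two_ne_zero, mul_comm _ (2 : ℝ),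
      mul_comm (Real.cos (2 * π * (i - p) / N)), ← mul_assoc]
    congr 1
    · congr 2
      push_cast
      ring
    · congr 1
      push_cast
      ring
  have hshift : ∀ m : ℤ, (N : ℤ) ∣ m →
      Real.cos (2 * π * n * x - 2 * π * m * p / N) = Real.cos (2 * π * n * x) := by
    rintro m ⟨k, rfl⟩
    rw [← Real.cos_sub_int_mul_two_pi (2 * π * n * x) (k * p)]
    congr 1
    push_cast
    field_simp
  rw [Finset.sum_congr rfl hprod, ← Finset.sum_div, Finset.sum_add_distrib,
    sum_range_cos_add_two_pi_mul_div hN, sum_range_cos_add_two_pi_mul_div hN, unitResidueCount]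
  split_ifs with h1 h2 h2
  · rw [hshift _ h1, hshift _ h2]
    field_simp
  · rw [hshift _ h1]
    field_simp
    ring
  · rw [hshift _ h2]
    field_simp
    ring
  · simp

theorem sum_range_cos_shift {p : ℕ} (hp : 1 ≤ p) :
    ∑ i ∈ Finset.range (2 * p + 1), Real.cos (2 * π * (i - p) / (2 * p + 1 : ℕ)) = 0 := by
  have h := sum_range_cos_add_two_pi_mul_div (N := 2 * p + 1) (by omega) 1
    (-(2 * π * p / (2 * p + 1 : ℕ)))
  rw [if_neg] at h
  · rw [← h]
    refine Finset.sum_congr rfl fun i _ => ?_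
    congr 1
    push_cast
    ring
  · intro hd
    have := Int.le_of_dvd one_pos hd
    omega

theorem sum_range_cos_shift_mul (p : ℕ) :
    ∑ i ∈ Finset.range (2 * p + 1),
      Real.cos (2 * π * (i - p) / (2 * p + 1 : ℕ)) * ((i : ℝ) - p) = 0 := by
  have h := Finset.sum_range_reflect (fun i : ℕ =>
    Real.cos (2 * π * (i - p) / (2 * p + 1 : ℕ)) * ((i : ℝ) - p)) (2 * p + 1)
  have h' : ∀ i ∈ Finset.range (2 * p + 1),
      Real.cos (2 * π * ((2 * p + 1 - 1 - i : ℕ) - p) / (2 * p + 1 : ℕ)) *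
        (((2 * p + 1 - 1 - i : ℕ) : ℝ) - p) =
      -(Real.cos (2 * π * (i - p) / (2 * p + 1 : ℕ)) * ((i : ℝ) - p)) := by
    intro i hi
    have hi' : i ≤ 2 * p := by
      have := Finset.mem_range.mp hi
      omega
    rw [Nat.add_sub_cancel, Nat.cast_sub hi', ← Real.cos_neg]
    push_cast
    rw [show -(2 * π * (2 * p - i - p) / (2 * p + 1)) =
      2 * π * ((i : ℝ) - p) / (2 * p + 1) by ring]
    ring
  rw [Finset.sum_congr rfl h', Finset.sum_neg_distrib] at h
  linarith

theorem exists_hasSum_unitResidueCount {p : ℕ} (hp : 1 ≤ p) :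
    ∃ K : ℝ, ∀ x : ℝ, (p : ℝ) / (2 * p + 1) ≤ x → x ≤ 1 / 2 →
      HasSum (fun n : ℕ => unitResidueCount (2 * p + 1) n / (n : ℝ) ^ 2 *
        Real.cos (2 * π * n * x)) K := by
  refine ⟨2 / (2 * p + 1 : ℕ) * ∑ i ∈ Finset.range (2 * p + 1),
    Real.cos (2 * π * (i - p) / (2 * p + 1 : ℕ)) *
      (π ^ 2 * (((i - p) / (2 * p + 1 : ℕ)) ^ 2)), fun x hx1 hx2 => ?_⟩
  have hN : (0 : ℝ) < 2 * p + 1 := by positivity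
  have hp2 : (p : ℝ) / (2 * p + 1) ≤ 1 / 2 := by
    rw [div_le_div_iff₀ hN two_pos]
    linarith
  have hterm : ∀ i ∈ Finset.range (2 * p + 1), HasSum
      (fun n : ℕ => Real.cos (2 * π * (i - p) / (2 * p + 1 : ℕ)) *
        (1 / (n : ℝ) ^ 2 * Real.cos (2 * π * n * (x + (i - p) / (2 * p + 1 : ℕ)))))
      (Real.cos (2 * π * (i - p) / (2 * p + 1 : ℕ)) *
        (π ^ 2 * ((x + (i - p) / (2 * p + 1 : ℕ)) ^ 2 -
          (x + (i - p) / (2 * p + 1 : ℕ)) + 1 / 6))) := by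
    intro i hi
    have hi' : (i : ℝ) ≤ 2 * p := by
      have := Finset.mem_range.mp hi
      exact_mod_cast (by omega : i ≤ 2 * p)
    refine (hasSum_cos_div_sq ?_ ?_).mul_left _
    · have : -((p : ℝ) / (2 * p + 1)) ≤ ((i : ℝ) - p) / (2 * p + 1 : ℕ) := by
        push_cast
        rw [← neg_div]
        gcongr
        linarith [(Nat.cast_nonneg i : (0 : ℝ) ≤ i)]
      linarith
    · have : ((i : ℝ) - p) / (2 * p + 1 : ℕ) ≤ (p : ℝ) / (2 * p + 1) := by
        push_cast
        gcongr
        linarith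
      linarith
  have hsum := (hasSum_sum hterm).mul_left (2 / ((2 * p + 1 : ℕ) : ℝ))
  convert! hsum using 1
  · ext n
    have h := unitResidueCount_mul_cos (N := 2 * p + 1) (by omega) p n x
    rw [div_mul_eq_mul_div, ← h, mul_div_assoc, Finset.sum_div]
    congr 1
    refine Finset.sum_congr rfl fun i _ => ?_
    ring
  · congr 1
    have hsplit : ∀ i ∈ Finset.range (2 * p + 1),
        Real.cos (2 * π * (i - p) / (2 * p + 1 : ℕ)) *
          (π ^ 2 * ((x + (i - p) / (2 * p + 1 : ℕ)) ^ 2 -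
            (x + (i - p) / (2 * p + 1 : ℕ)) + 1 / 6)) =
        Real.cos (2 * π * (i - p) / (2 * p + 1 : ℕ)) *
          (π ^ 2 * (((i - p) / (2 * p + 1 : ℕ)) ^ 2)) +
        (Real.cos (2 * π * (i - p) / (2 * p + 1 : ℕ)) * (π ^ 2 * (x ^ 2 - x + 1 / 6)) +
        Real.cos (2 * π * (i - p) / (2 * p + 1 : ℕ)) * ((i : ℝ) - p) *
          (π ^ 2 * (2 * x - 1) / (2 * p + 1 : ℕ))) := by
      intro i _
      ring
    rw [Finset.sum_congr rfl hsplit, Finset.sum_add_distrib, Finset.sum_add_distrib,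
      ← Finset.sum_mul, ← Finset.sum_mul, sum_range_cos_shift hp, sum_range_cos_shift_mul]
    ring

theorem unitResidueCount_mul_cos_node (p n : ℕ) :
    unitResidueCount (2 * p + 1) n * Real.cos (2 * π * n * (p / (2 * p + 1))) =
      -(unitResidueCount (2 * p + 1) n * Real.cos (π / (2 * p + 1))) := by
  have hN : (2 * p + 1 : ℝ) ≠ 0 := by positivity
  have hbase : Real.cos (2 * π * p / (2 * p + 1)) = -Real.cos (π / (2 * p + 1)) := by
    rw [← Real.cos_pi_sub]
    congr 1
    field_simp
    ring
  have hplus : ((2 * p + 1 : ℕ) : ℤ) ∣ n + 1 →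
      Real.cos (2 * π * n * (p / (2 * p + 1))) = -Real.cos (π / (2 * p + 1)) := by
    rintro ⟨k, hk⟩
    have hk' : (n : ℝ) = (2 * p + 1) * k - 1 := by
      have : (n : ℝ) + 1 = (2 * p + 1) * k := by exact_mod_cast hk
      linarith
    rw [← hbase, ← Real.cos_neg (2 * π * p / (2 * p + 1)),
      ← Real.cos_add_int_mul_two_pi (-(2 * π * p / (2 * p + 1))) (k * p), hk']
    congr 1
    push_cast
    field_simp
    ring
  have hminus : ((2 * p + 1 : ℕ) : ℤ) ∣ n - 1 →
      Real.cos (2 * π * n * (p / (2 * p + 1))) = -Real.cos (π / (2 * p + 1)) := by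
    rintro ⟨k, hk⟩
    have hk' : (n : ℝ) = (2 * p + 1) * k + 1 := by
      have : (n : ℝ) - 1 = (2 * p + 1) * k := by exact_mod_cast hk
      linarith
    rw [← hbase, ← Real.cos_add_int_mul_two_pi (2 * π * p / (2 * p + 1)) (k * p), hk']
    congr 1
    push_cast
    field_simp
    ring
  unfold unitResidueCount
  split_ifs with h1 h2 h2
  · rw [hplus h1]; ring
  · rw [hplus h1]; ring
  · rw [hminus h2]; ring
  · simp

theorem cos_pi_div_two_mul_add_one_pos {p : ℕ} (hp : 1 ≤ p) :
    0 < Real.cos (π / (2 * (p : ℝ) + 1)) := by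
  have hp' : (1 : ℝ) ≤ p := by exact_mod_cast hp
  apply Real.cos_pos_of_mem_Ioo
  constructor
  · have : 0 < π / (2 * (p : ℝ) + 1) := by positivity
    linarith [pi_pos]
  · gcongr
    linarith

theorem memK_zero_coeff_le {p : ℕ} (hp : 1 ≤ p) {a : ℕ → ℝ}
    (ha : memK ((p : ℝ) / (2 * p + 1)) a) :
    a 0 ≤ Real.cos (π / (2 * (p : ℝ) + 1)) / (1 + Real.cos (π / (2 * (p : ℝ) + 1))) := by
  obtain ⟨hnn, hsum, hone, hvan⟩ := ha
  have hc := cos_pi_div_two_mul_add_one_pos hp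
  set c := Real.cos (π / (2 * (p : ℝ) + 1)) with hcdef
  have hN : (0 : ℝ) < 2 * p + 1 := by positivity
  set x : ℝ := (p : ℝ) / (2 * p + 1) with hx
  have hx0 : 0 ≤ x := by positivity
  have hx2 : x ≤ 1 / 2 := by
    rw [hx, div_le_div_iff₀ hN two_pos]
    linarith
  have hzero := hvan x (le_abs_self x) (by rwa [abs_of_nonneg hx0])
  have hscos : Summable fun n : ℕ => a n * Real.cos (2 * π * n * x) := by
    refine hsum.of_norm_bounded fun n => ?_
    rw [Real.norm_eq_abs, abs_mul, abs_of_nonneg (hnn n)]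
    exact mul_le_of_le_one_right (hnn n) (Real.abs_cos_le_one _)
  have h1 : HasSum (fun n : ℕ => a n * Real.cos (2 * π * n * x) + a n * c) (0 + 1 * c) :=
    (hzero ▸ hscos.hasSum).add ((hone ▸ hsum.hasSum).mul_right c)
  have hle : ∀ n : ℕ, -c ≤ Real.cos (2 * π * n * x) := by
    intro n
    have h := cos_pi_mul_odd_div_le (N := 2 * p + 1) (by omega)
      (u := 2 * (n * p) - (2 * p + 1)) (by exact ⟨n * p - p - 1, by ring⟩)
    have heq : π * ((2 * (n * p) - (2 * p + 1) : ℤ) : ℝ) / ((2 * p + 1 : ℕ) : ℝ) =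
        2 * π * n * x - π := by
      rw [hx]
      push_cast
      field_simp
    rw [heq, Real.cos_sub_pi] at h
    push_cast at h
    linarith
  have h2 := le_hasSum h1 0 fun n _ => by
    rw [← mul_add]
    exact mul_nonneg (hnn n) (by linarith [hle n])
  rw [le_div_iff₀ (by linarith)]
  simp at h2
  linarith

theorem exists_memK_zero_coeff_eq {p : ℕ} (hp : 1 ≤ p) :
    ∃ a : ℕ → ℝ, memK ((p : ℝ) / (2 * p + 1)) a ∧
      Real.cos (π / (2 * (p : ℝ) + 1)) / (1 + Real.cos (π / (2 * (p : ℝ) + 1))) = a 0 := by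
  have hc := cos_pi_div_two_mul_add_one_pos hp
  set c := Real.cos (π / (2 * (p : ℝ) + 1)) with hcdef
  have hN : (0 : ℝ) < 2 * p + 1 := by positivity
  obtain ⟨K, hK⟩ := exists_hasSum_unitResidueCount hp
  set d : ℕ → ℝ := fun n => unitResidueCount (2 * p + 1) n / (n : ℝ) ^ 2 with hd
  have hd0 : d 0 = 0 := by simp [hd]
  have hdnn : ∀ n, 0 ≤ d n := fun n => div_nonneg (unitResidueCount_nonneg _ _) (by positivity)
  have hd1 : 0 < d 1 := by
    simp only [hd, unitResidueCount]
    norm_num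
    positivity
  have hnode : HasSum (fun n => d n * -c) K := by
    convert! hK _ le_rfl (by rw [div_le_div_iff₀ hN two_pos]; linarith) using 2 with n
    have h := unitResidueCount_mul_cos_node p n
    simp only [hd]
    rw [div_mul_eq_mul_div, div_mul_eq_mul_div, h, hcdef, mul_neg]
  have hds : Summable d := (summable_mul_right_iff (neg_ne_zero.mpr hc.ne')).mp hnode.summable
  set s := ∑' n, d n with hs
  have hKs : K = s * -c := hnode.unique (hds.hasSum.mul_right _)
  have hspos : 0 < s := hds.tsum_pos hdnn 1 hd1
  have hc1 : 0 < 1 + c := by linarith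
  set b : ℕ → ℝ := fun n => (if n = 0 then c / (1 + c) else 0) + d n * (1 / (s * (1 + c))) with hb
  refine ⟨b, ⟨?_, ?_⟩, by simp [hb, hd0]⟩
  · intro n
    refine add_nonneg ?_ (mul_nonneg (hdnn n) (by positivity))
    split_ifs <;> positivity
  have hbs : ∀ x L, HasSum (fun n : ℕ => d n * Real.cos (2 * π * n * x)) L →
      HasSum (fun n : ℕ => b n * Real.cos (2 * π * n * x))
        (c / (1 + c) + L * (1 / (s * (1 + c)))) := by
    intro x L hL
    convert! (hasSum_ite_eq 0 (c / (1 + c))).add (hL.mul_right (1 / (s * (1 + c)))) using 2 with n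
    by_cases hn : n = 0
    · subst hn
      simp [hb]
    · simp only [hb, hn, if_false]
      ring
  have hb1 : HasSum b 1 := by
    have h := hbs 0 s (by simpa using hds.hasSum)
    simp only [mul_zero, Real.cos_zero, mul_one] at h
    convert! h using 1
    field_simp
    ring
  refine ⟨hb1.summable, hb1.tsum_eq, fun x hx1 hx2 => ?_⟩
  have habs : ∀ n : ℕ, Real.cos (2 * π * n * x) = Real.cos (2 * π * n * |x|) := by
    intro n
    rcases abs_choice x with h | h <;> rw [h]
    rw [mul_neg, Real.cos_neg]
  simp only [habs]
  rw [(hbs _ _ (hK _ hx1 hx2)).tsum_eq, hKs]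
  field_simp
  ring

/-- Theorem 4: for every integer `p ≥ 1` and `h = p/(2p+1)`,
`A(p/(2p+1)) = cos (π/(2p+1)) / (1 + cos (π/(2p+1)))`. -/
theorem turanA_p_div_two_p_add_one (p : ℕ) (hp : 1 ≤ p) :
    turanA ((p : ℝ) / (2 * p + 1)) =
      Real.cos (π / (2 * (p : ℝ) + 1)) / (1 + Real.cos (π / (2 * (p : ℝ) + 1))) := by
  refine IsGreatest.csSup_eq ⟨exists_memK_zero_coeff_eq hp, ?_⟩
  rintro _ ⟨a, ha, rfl⟩
  exact memK_zero_coeff_le hp ha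
end

section
/- For every integer p ≥ 1 and q = 2p+1, the supremum A(p/(2p+1)) is attained by the 1-periodic even piecewise linear function φ_{p,2p+1} with vertices at the points (±k/q, b_k*) for k = 0, 1, …, p, where b_k* = (cos(π/(2p+1)) + cos(2πk/(2p+1))) / (1 + cos(π/(2p+1))); in particular b₀* = 1, b_p* = 0, φ_{p,2p+1} ∈ K(p/(2p+1)), and its mean value equals cos(π/(2p+1))/(1 + cos(π/(2p+1))). -/
open Real

/-- The even piecewise linear function (restricted to `[-1/2, 1/2]` and extended
1-periodically) with vertices `(± k/q, b k)`, `k = 0, 1, …, p`: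
`φ x = b k + (b k - b (k+1)) (k - q|x|)` for `k/q ≤ |x| < (k+1)/q` and
`φ x = 0` for `p/q ≤ |x| ≤ 1/2`. -/
noncomputable def phiPL (p q : ℕ) (b : ℕ → ℝ) (x : ℝ) : ℝ :=
  if |x| < (p : ℝ) / q then
    b ⌊(q : ℝ) * |x|⌋₊ + (b ⌊(q : ℝ) * |x|⌋₊ - b (⌊(q : ℝ) * |x|⌋₊ + 1)) *
      ((⌊(q : ℝ) * |x|⌋₊ : ℝ) - q * |x|)
  else 0

theorem neg_cos_pi_div_le_cos {q : ℕ} (hq : Odd q) (m : ℕ) :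
    -Real.cos (π / q) ≤ Real.cos (2 * π * m / q) := by
  have hq0 : 0 < q := hq.pos
  have hqR : (0 : ℝ) < q := by exact_mod_cast hq0
  have hlt := Nat.mod_lt m hq0
  have hdm := Nat.div_add_mod m q
  set s := m % q with hs
  set t := m / q
  have h1 : Real.cos (2 * π * m / q) = Real.cos (2 * π * s / q) := by
    have : 2 * π * m / q = 2 * π * s / q + t * (2 * π) := by
      rw [← hdm]; push_cast; field_simp; ring
    rw [this, Real.cos_add_nat_mul_two_pi]
  have h2 : Real.cos (2 * π * s / q) = -Real.cos |π * (q - 2 * s) / q| := by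
    rw [Real.cos_abs, ← Real.cos_pi_sub]
    congr 1; field_simp; ring
  rw [h1, h2, neg_le_neg_iff]
  have h3 : (1 : ℝ) ≤ |(q : ℝ) - 2 * s| := by
    have : (1 : ℤ) ≤ |(q : ℤ) - 2 * s| := by
      apply Int.one_le_abs
      obtain ⟨r, hr⟩ := hq
      omega
    exact_mod_cast this
  have h4 : |(q : ℝ) - 2 * s| ≤ q := by
    have : (s : ℝ) ≤ q := by exact_mod_cast hlt.le
    have : (0 : ℝ) ≤ s := by positivity
    rw [abs_le]; constructor <;> linarith
  have h5 : |π * (q - 2 * s) / q| = π * |(q : ℝ) - 2 * s| / q := by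
    rw [abs_div, abs_mul, abs_of_pos Real.pi_pos, abs_of_pos hqR]
  rw [h5]
  apply Real.cos_le_cos_of_nonneg_of_le_pi
  · positivity
  · rw [div_le_iff₀ hqR]; exact mul_le_mul_of_nonneg_left h4 Real.pi_pos.le
  · gcongr; nlinarith [Real.pi_pos]

/-- Sampling an element of `K(p/q)` at `0` and `p/q` bounds its mean value. -/
theorem memK_mean_le {p q : ℕ} (hp : 1 ≤ p) (hq : q = 2 * p + 1) {a : ℕ → ℝ}
    (ha : memK ((p : ℝ) / q) a) :
    a 0 ≤ Real.cos (π / q) / (1 + Real.cos (π / q)) := by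
  obtain ⟨h0, hs, h1, hz⟩ := ha
  have hqR : (0 : ℝ) < q := by rw [hq]; positivity
  have hqp : (q : ℝ) = 2 * p + 1 := by rw [hq]; push_cast; ring
  have hp1 : (1 : ℝ) ≤ p := by exact_mod_cast hp
  set c := Real.cos (π / q) with hc
  have hcpos : 0 < c := by
    apply Real.cos_pos_of_mem_Ioo
    constructor
    · have : 0 < π / q := by positivity
      linarith [Real.pi_pos]
    · apply div_lt_div_of_pos_left Real.pi_pos <;> linarith
  have hpabs : |(p : ℝ) / q| = p / q := abs_of_nonneg (by positivity)
  have hz' := hz (p / q) hpabs.ge (by rw [hpabs, div_le_div_iff₀ hqR two_pos]; linarith)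
  have hs2 : Summable fun n : ℕ => a n * Real.cos (2 * π * n * (p / q)) := by
    apply Summable.of_norm_bounded hs
    intro n
    rw [norm_mul, Real.norm_eq_abs, Real.norm_eq_abs, abs_of_nonneg (h0 n)]
    exact mul_le_of_le_one_right (h0 n) (Real.abs_cos_le_one _)
  have hsum : HasSum (fun n : ℕ => a n * c + a n * Real.cos (2 * π * n * (p / q))) (1 * c + 0) := by
    have hA := hs.hasSum
    rw [h1] at hA
    have hB := hs2.hasSum
    rw [hz'] at hB
    exact (hA.mul_right c).add hB
  have hle := hsum.summable.le_tsum 0 (fun n _ => by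
    have h := neg_cos_pi_div_le_cos (q := q) ⟨p, hq⟩ (n * p)
    have e : 2 * π * n * (p / q) = 2 * π * ((n * p : ℕ) : ℝ) / q := by push_cast; ring
    rw [e, ← mul_add]
    exact mul_nonneg (h0 n) (by linarith))
  rw [hsum.tsum_eq] at hle
  simp only [Nat.cast_zero, mul_zero, zero_mul, Real.cos_zero] at hle
  rw [le_div_iff₀ (by linarith)]
  linarith

theorem sum_range_cos_add_mul_div {q : ℕ} (hq : q ≠ 0) (m : ℤ) (θ : ℝ) :
    ∑ j ∈ Finset.range q, Real.cos (θ + 2 * π * j * m / q) =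
      if (q : ℤ) ∣ m then q * Real.cos θ else 0 := by
  have hqC : (q : ℂ) ≠ 0 := by exact_mod_cast hq
  set ζ : ℂ := Complex.exp (2 * π * Complex.I / q) with hζ
  have hprim : IsPrimitiveRoot ζ q := Complex.isPrimitiveRoot_exp q hq
  have hterm : ∀ j : ℕ, Real.cos (θ + 2 * π * j * m / q) =
      (Complex.exp (θ * Complex.I) * (ζ ^ m) ^ j).re := by
    intro j
    have : Complex.exp (θ * Complex.I) * (ζ ^ m) ^ j =
        Complex.exp (((θ + 2 * π * j * m / q : ℝ) : ℂ) * Complex.I) := by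
      rw [hζ, ← Complex.exp_int_mul, ← Complex.exp_nat_mul, ← Complex.exp_add]
      congr 1; push_cast; field_simp
    rw [this, Complex.exp_ofReal_mul_I_re]
  simp_rw [hterm]
  rw [← Complex.re_sum, ← Finset.mul_sum]
  split_ifs with h
  · rw [(hprim.zpow_eq_one_iff_dvd m).2 h]
    simp only [one_pow, Finset.sum_const, Finset.card_range, nsmul_eq_mul, mul_one]
    rw [mul_comm, ← Complex.ofReal_natCast, Complex.re_ofReal_mul, Complex.exp_ofReal_mul_I_re]
  · have hne : ζ ^ m ≠ 1 := fun e => h ((hprim.zpow_eq_one_iff_dvd m).1 e)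
    have hpow : (ζ ^ m) ^ q = 1 := by
      rw [← zpow_natCast, ← zpow_mul, mul_comm, zpow_mul, zpow_natCast, hprim.pow_eq_one, one_zpow]
    rw [geom_sum_eq hne, hpow]
    simp

/-- `q / 2` times the number of residues among `±1` hit by `n` modulo `q`. -/
noncomputable def unitResidueWeight (q n : ℕ) : ℝ :=
  ((if (q : ℤ) ∣ n + 1 then (q : ℝ) else 0) + (if (q : ℤ) ∣ n - 1 then (q : ℝ) else 0)) / 2

theorem unitResidueWeight_nonneg (q n : ℕ) : 0 ≤ unitResidueWeight q n := by
  unfold unitResidueWeight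
  split_ifs <;> positivity

theorem unitResidueWeight_one_pos {q : ℕ} (hq : q ≠ 0) : 0 < unitResidueWeight q 1 := by
  have : (0 : ℝ) < q := by positivity
  unfold unitResidueWeight
  split_ifs <;> simp_all

theorem sum_range_cos_mul_cos {q : ℕ} (hq : q ≠ 0) (n : ℕ) (x : ℝ) :
    ∑ j ∈ Finset.range q, Real.cos (2 * π * j / q) * Real.cos (2 * π * n * (x + j / q)) =
      unitResidueWeight q n * Real.cos (2 * π * n * x) := by
  have hqR : (q : ℝ) ≠ 0 := by exact_mod_cast hq
  have hterm : ∀ j : ℕ, Real.cos (2 * π * j / q) * Real.cos (2 * π * n * (x + j / q)) =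
      (Real.cos (2 * π * n * x + 2 * π * j * ((n + 1 : ℤ) : ℝ) / q) +
        Real.cos (2 * π * n * x + 2 * π * j * ((n - 1 : ℤ) : ℝ) / q)) / 2 := by
    intro j
    have e1 : 2 * π * n * x + 2 * π * j * ((n + 1 : ℤ) : ℝ) / q =
        2 * π * n * (x + j / q) + 2 * π * j / q := by push_cast; ring
    have e2 : 2 * π * n * x + 2 * π * j * ((n - 1 : ℤ) : ℝ) / q =
        2 * π * n * (x + j / q) - 2 * π * j / q := by push_cast; ring
    rw [e1, e2, Real.cos_add, Real.cos_sub]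
    ring
  simp_rw [hterm]
  rw [← Finset.sum_div, Finset.sum_add_distrib, sum_range_cos_add_mul_div hq,
    sum_range_cos_add_mul_div hq]
  unfold unitResidueWeight
  split_ifs <;> ring

theorem unitResidueWeight_mul_cos {q : ℕ} (hq : q ≠ 0) (n k : ℕ) :
    unitResidueWeight q n * Real.cos (2 * π * n * (k / q)) =
      unitResidueWeight q n * Real.cos (2 * π * k / q) := by
  have hqR : (q : ℝ) ≠ 0 := by exact_mod_cast hq
  by_cases h : (q : ℤ) ∣ n + 1
  · obtain ⟨t, ht⟩ := h
    have hn : (n : ℝ) = q * t - 1 := by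
      have : ((n : ℤ) : ℝ) = ((q * t - 1 : ℤ) : ℝ) := by rw [← ht]; push_cast; ring
      simpa using this
    congr 1
    have : 2 * π * n * (k / q) = ((t * k : ℤ) : ℝ) * (2 * π) - 2 * π * k / q := by
      rw [hn]; push_cast; field_simp
    rw [this, Real.cos_int_mul_two_pi_sub]
  by_cases h' : (q : ℤ) ∣ n - 1
  · obtain ⟨t, ht⟩ := h'
    have hn : (n : ℝ) = q * t + 1 := by
      have : ((n : ℤ) : ℝ) = ((q * t + 1 : ℤ) : ℝ) := by rw [← ht]; push_cast; ring
      simpa using this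
    congr 1
    have : 2 * π * n * (k / q) = 2 * π * k / q + ((t * k : ℤ) : ℝ) * (2 * π) := by
      rw [hn]; push_cast; field_simp; ring
    rw [this, Real.cos_add_int_mul_two_pi]
  · simp [unitResidueWeight, h, h']

/-- The function `∑ cos (2πnx) / n²`. -/
noncomputable def cosDivSqSum (x : ℝ) : ℝ :=
  ∑' n : ℕ, 1 / (n : ℝ) ^ 2 * Real.cos (2 * π * n * x)

theorem hasSum_cosDivSqSum (x : ℝ) :
    HasSum (fun n : ℕ => 1 / (n : ℝ) ^ 2 * Real.cos (2 * π * n * x)) (cosDivSqSum x) := by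
  apply Summable.hasSum
  apply Summable.of_norm_bounded (Real.summable_one_div_nat_pow.2 one_lt_two)
  intro n
  rw [norm_mul, Real.norm_eq_abs, Real.norm_eq_abs, abs_of_nonneg (by positivity)]
  exact mul_le_of_le_one_right (by positivity) (Real.abs_cos_le_one _)

theorem cosDivSqSum_sub_int (x : ℝ) (t : ℤ) : cosDivSqSum (x - t) = cosDivSqSum x := by
  unfold cosDivSqSum
  congr 1; ext n
  have : 2 * π * n * (x - t) = 2 * π * n * x - ((n * t : ℤ) : ℝ) * (2 * π) := by push_cast; ring
  rw [this, Real.cos_sub_int_mul_two_pi]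

theorem cosDivSqSum_eq {x : ℝ} (hx : x ∈ Set.Icc (0 : ℝ) 1) :
    cosDivSqSum x = π ^ 2 * (x ^ 2 - x + 1 / 6) := by
  have h := hasSum_one_div_nat_pow_mul_cos one_ne_zero hx
  have h2 := (hasSum_cosDivSqSum x).unique h
  rw [h2]
  simp [Polynomial.bernoulli, Finset.sum_range_succ, Polynomial.eval_add]
  ring

theorem cosDivSqSum_eq_on_cell {q : ℕ} (hq : q ≠ 0) (m : ℤ) :
    ∃ α β : ℝ, ∀ x ∈ Set.Icc ((m : ℝ) / q) ((m + 1) / q),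
      cosDivSqSum x = π ^ 2 * x ^ 2 + α * x + β := by
  have hqR : (0 : ℝ) < q := by positivity
  have hqZ : (0 : ℤ) < q := by positivity
  have hdm := Int.mul_ediv_add_emod m q
  have hlt := Int.emod_lt_of_pos m hqZ
  have hge := Int.emod_nonneg m hqZ.ne'
  set t := m / (q : ℤ)
  have h1 : (t : ℝ) * q ≤ m := by
    have : t * q ≤ m := by linarith
    exact_mod_cast this
  have h2 : (m : ℝ) + 1 ≤ (t + 1) * q := by
    have : m + 1 ≤ (t + 1) * q := by linarith
    exact_mod_cast this
  refine ⟨π ^ 2 * (-2 * t - 1), π ^ 2 * (t ^ 2 + t + 1 / 6), fun x hx => ?_⟩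
  obtain ⟨ha, hb⟩ := hx
  rw [div_le_iff₀ hqR] at ha
  rw [le_div_iff₀ hqR] at hb
  rw [← cosDivSqSum_sub_int x t, cosDivSqSum_eq]
  · ring
  · constructor
    · have := le_of_mul_le_mul_right (h1.trans ha) hqR
      linarith
    · have := le_of_mul_le_mul_right (hb.trans h2) hqR
      linarith

/-- The function `∑ w n * cos (2πnx) / n²` with `w` the weight `unitResidueWeight q`. -/
noncomputable def unitResidueCosSum (q : ℕ) (x : ℝ) : ℝ :=
  ∑ j ∈ Finset.range q, Real.cos (2 * π * j / q) * cosDivSqSum (x + j / q)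

theorem hasSum_unitResidueCosSum {q : ℕ} (hq : q ≠ 0) (x : ℝ) :
    HasSum (fun n : ℕ => unitResidueWeight q n / (n : ℝ) ^ 2 * Real.cos (2 * π * n * x))
      (unitResidueCosSum q x) := by
  have h := hasSum_sum (s := Finset.range q) (fun j _ =>
    (hasSum_cosDivSqSum (x + j / q)).mul_left (Real.cos (2 * π * j / q)))
  refine (congrArg (HasSum · _) (funext fun n => ?_)).mpr h
  rw [div_mul_eq_mul_div, ← sum_range_cos_mul_cos hq, Finset.sum_div]
  exact Finset.sum_congr rfl fun j _ => by ring

theorem unitResidueCosSum_vertex {q : ℕ} (hq : q ≠ 0) (k : ℕ) :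
    unitResidueCosSum q (k / q) = Real.cos (2 * π * k / q) * unitResidueCosSum q 0 := by
  refine (hasSum_unitResidueCosSum hq _).unique ?_
  refine (congrArg (HasSum · _) (funext fun n => ?_)).mpr
    ((hasSum_unitResidueCosSum hq 0).mul_left (Real.cos (2 * π * k / q)))
  rw [div_mul_eq_mul_div, unitResidueWeight_mul_cos hq]
  simp only [mul_zero, Real.cos_zero]
  ring

theorem unitResidueCosSum_zero_pos {q : ℕ} (hq : q ≠ 0) : 0 < unitResidueCosSum q 0 := by
  have h := hasSum_unitResidueCosSum hq 0
  simp only [mul_zero, Real.cos_zero, mul_one] at h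
  rw [← h.tsum_eq]
  refine h.summable.tsum_pos (fun n => ?_) 1 ?_
  · have := unitResidueWeight_nonneg q n
    positivity
  · have := unitResidueWeight_one_pos hq
    simpa using this

theorem unitResidueCosSum_neg {q : ℕ} (hq : q ≠ 0) (x : ℝ) :
    unitResidueCosSum q (-x) = unitResidueCosSum q x := by
  refine (hasSum_unitResidueCosSum hq _).unique ?_
  convert hasSum_unitResidueCosSum hq x using 3 with n
  rw [mul_neg, Real.cos_neg]

theorem unitResidueCosSum_affine_on_cell {q : ℕ} (hq : 2 ≤ q) (k : ℕ) :
    ∃ α β : ℝ, ∀ x ∈ Set.Icc ((k : ℝ) / q) ((k + 1) / q),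
      unitResidueCosSum q x = α * x + β := by
  have hq0 : q ≠ 0 := by omega
  choose α β h using fun m : ℤ => cosDivSqSum_eq_on_cell hq0 m
  have hcos : ∑ j ∈ Finset.range q, Real.cos (2 * π * j / q) = 0 := by
    have := sum_range_cos_add_mul_div hq0 1 0
    rw [if_neg (by intro hd; have := Int.le_of_dvd one_pos hd; omega)] at this
    simpa using this
  refine ⟨∑ j ∈ Finset.range q, Real.cos (2 * π * j / q) * (2 * π ^ 2 * (j / q) + α (k + j)),
    ∑ j ∈ Finset.range q, Real.cos (2 * π * j / q) *
      (π ^ 2 * (j / q) ^ 2 + α (k + j) * (j / q) + β (k + j)), fun x hx => ?_⟩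
  have hz : unitResidueCosSum q x = unitResidueCosSum q x -
      (∑ j ∈ Finset.range q, Real.cos (2 * π * j / q)) * (π ^ 2 * x ^ 2) := by rw [hcos]; ring
  rw [hz]
  unfold unitResidueCosSum
  rw [Finset.sum_mul, Finset.sum_mul, ← Finset.sum_sub_distrib, ← Finset.sum_add_distrib]
  refine Finset.sum_congr rfl fun j _ => ?_
  rw [h (k + j) (x + j / q)]
  · ring
  · obtain ⟨h1, h2⟩ := hx
    push_cast
    constructor
    · rw [add_div]; linarith
    · have : ((k : ℝ) + j + 1) / q = (k + 1) / q + j / q := by ring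
      rw [this]; linarith

/-- On each cell `[k/q, (k+1)/q]`, linear interpolation between the vertex values is exact. -/
theorem unitResidueCosSum_interpolation {q : ℕ} (hq : 2 ≤ q) (k : ℕ) {x : ℝ}
    (h1 : (k : ℝ) ≤ q * x) (h2 : q * x ≤ k + 1) :
    unitResidueCosSum q x = (Real.cos (2 * π * k / q) +
      (Real.cos (2 * π * k / q) - Real.cos (2 * π * (k + 1 : ℕ) / q)) * (k - q * x)) *
        unitResidueCosSum q 0 := by
  have hq0 : q ≠ 0 := by omega
  have hqR : (0 : ℝ) < q := by positivity
  obtain ⟨α, β, h⟩ := unitResidueCosSum_affine_on_cell hq k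
  have hk : (k : ℝ) / q ≤ (k + 1) / q := by gcongr; linarith
  have e0 := h (k / q) ⟨le_rfl, hk⟩
  have e1 := h ((k + 1) / q) ⟨hk, le_rfl⟩
  have ex := h x ⟨by rw [div_le_iff₀ hqR]; linarith, by rw [le_div_iff₀ hqR]; linarith⟩
  have v0 := unitResidueCosSum_vertex hq0 k
  have v1 := unitResidueCosSum_vertex hq0 (k + 1)
  push_cast at v1 ⊢
  have : (Real.cos (2 * π * k / q) +
      (Real.cos (2 * π * k / q) - Real.cos (2 * π * (k + 1) / q)) * (k - q * x)) *
        unitResidueCosSum q 0 = (α * (k / q) + β) +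
        ((α * (k / q) + β) - (α * ((k + 1) / q) + β)) * (k - q * x) := by
    rw [← e0, ← e1, v0, v1]; ring
  rw [this, ex]
  field_simp
  ring

theorem integral_cosine_series {a : ℕ → ℝ} (ha : Summable a) (h0 : ∀ n, 0 ≤ a n) :
    ∫ x in (-(1 / 2) : ℝ)..(1 / 2), ∑' n : ℕ, a n * Real.cos (2 * π * n * x) = a 0 := by
  let f : ℕ → C(ℝ, ℝ) := fun n => ⟨fun x => a n * Real.cos (2 * π * n * x), by fun_prop⟩
  have hs : Summable fun n => ‖(f n).restrict (⟨Set.uIcc (-(1 / 2) : ℝ) (1 / 2),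
      isCompact_uIcc⟩ : TopologicalSpace.Compacts ℝ)‖ := by
    refine Summable.of_nonneg_of_le (fun n => norm_nonneg _) (fun n => ?_) ha
    rw [ContinuousMap.norm_le _ (h0 n)]
    intro x
    change ‖a n * Real.cos (2 * π * n * x)‖ ≤ a n
    rw [norm_mul, Real.norm_eq_abs, Real.norm_eq_abs, abs_of_nonneg (h0 n)]
    exact mul_le_of_le_one_right (h0 n) (Real.abs_cos_le_one _)
  have h := intervalIntegral.hasSum_intervalIntegral_of_summable_norm hs
  have h2 := h.unique (hasSum_single 0 fun n hn => ?_)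
  · change ∫ x in (-(1 / 2) : ℝ)..(1 / 2), ∑' n : ℕ, f n x = a 0
    rw [h2]
    simp [f]
    norm_num
  · have hnR : (n : ℝ) ≠ 0 := by exact_mod_cast hn
    have hne : 2 * π * n ≠ 0 := by positivity
    change ∫ x in (-(1 / 2) : ℝ)..(1 / 2), a n * Real.cos (2 * π * n * x) = 0
    rw [intervalIntegral.integral_const_mul, intervalIntegral.integral_comp_mul_left _ hne,
      integral_cos]
    have e1 : 2 * π * n * (1 / 2) = n * π := by ring
    have e2 : 2 * π * n * -(1 / 2) = -(n * π) := by ring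
    rw [e1, e2, Real.sin_neg, Real.sin_nat_mul_pi]
    simp

/-- Theorem 4, extremal function: for `p ≥ 1` and `q = 2p+1`, the supremum `A(p/(2p+1))`
is attained by the 1-periodic even piecewise linear function with vertices
`(± k/q, b* k)`, `b* k = (cos (π/q) + cos (2πk/q)) / (1 + cos (π/q))`; in particular
`b* 0 = 1`, `b* p = 0`, `φ_{p,2p+1} ∈ K(p/(2p+1))`, and its mean value equals
`cos (π/(2p+1)) / (1 + cos (π/(2p+1)))`. -/
theorem turanA_extremal_p_div_two_p_add_one (p : ℕ) (hp : 1 ≤ p) (q : ℕ)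
    (hq : q = 2 * p + 1) (b : ℕ → ℝ)
    (hb : ∀ k : ℕ, b k =
      (Real.cos (π / q) + Real.cos (2 * π * k / q)) / (1 + Real.cos (π / q))) :
    b 0 = 1 ∧ b p = 0 ∧
    (∫ x in (-(1 / 2) : ℝ)..(1 / 2), phiPL p q b x) =
      Real.cos (π / q) / (1 + Real.cos (π / q)) ∧
    ∃ a : ℕ → ℝ, memK ((p : ℝ) / q) a ∧
      (∀ x : ℝ, |x| ≤ 1 / 2 →
        (∑' n : ℕ, a n * Real.cos (2 * π * n * x)) = phiPL p q b x) ∧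
      a 0 = turanA ((p : ℝ) / q) ∧
      a 0 = Real.cos (π / q) / (1 + Real.cos (π / q)) := by
  have hq0 : q ≠ 0 := by omega
  have hq2 : 2 ≤ q := by omega
  have hqR : (0 : ℝ) < q := by positivity
  have hqp : (q : ℝ) = 2 * p + 1 := by rw [hq]; push_cast; ring
  have hp1 : (1 : ℝ) ≤ p := by exact_mod_cast hp
  have hcosp : Real.cos (2 * π * p / q) = -Real.cos (π / q) := by
    rw [← Real.cos_pi_sub]
    congr 1
    field_simp
    rw [hqp]; ring
  have hcosp' : Real.cos (2 * π * (p + 1 : ℕ) / q) = -Real.cos (π / q) := by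
    rw [← Real.cos_add_pi]
    congr 1
    push_cast
    field_simp
    rw [hqp]; ring
  set c := Real.cos (π / q) with hc
  have hcpos : 0 < c := by
    apply Real.cos_pos_of_mem_Ioo
    constructor
    · have : 0 < π / q := by positivity
      linarith [Real.pi_pos]
    · apply div_lt_div_of_pos_left Real.pi_pos <;> linarith
  have hc1 : 1 + c ≠ 0 := by positivity
  have hbp : b p = 0 := by rw [hb, hcosp]; simp
  set G := unitResidueCosSum q 0 with hG
  have hGpos : 0 < G := unitResidueCosSum_zero_pos hq0
  obtain ⟨a, ha⟩ : ∃ a : ℕ → ℝ, a = fun n => (if n = 0 then c / (1 + c) else 0) +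
    1 / ((1 + c) * G) * (unitResidueWeight q n / (n : ℝ) ^ 2) := ⟨_, rfl⟩
  have ha0 : a 0 = c / (1 + c) := by simp [ha]
  have hnonneg : ∀ n, 0 ≤ a n := by
    intro n
    have := unitResidueWeight_nonneg q n
    rw [ha]
    refine add_nonneg ?_ (by positivity)
    split_ifs <;> positivity
  have hsum : ∀ x : ℝ, HasSum (fun n : ℕ => a n * Real.cos (2 * π * n * x))
      (c / (1 + c) + 1 / ((1 + c) * G) * unitResidueCosSum q x) := by
    intro x
    have h1 : HasSum (fun n : ℕ => if n = 0 then c / (1 + c) else 0) (c / (1 + c)) :=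
      hasSum_ite_eq 0 _
    convert h1.add ((hasSum_unitResidueCosSum hq0 x).mul_left (1 / ((1 + c) * G))) using 2 with n
    rw [ha]
    by_cases hn : n = 0
    · simp [hn]
    · simp only [hn, if_false]
      ring
  have hsum0 : HasSum a 1 := by
    have h := hsum 0
    simp only [mul_zero, Real.cos_zero, mul_one] at h
    convert h using 1
    rw [← hG]; field_simp; ring
  have hcell : ∀ (k : ℕ) (x : ℝ), (k : ℝ) ≤ q * x → q * x ≤ k + 1 →
      c / (1 + c) + 1 / ((1 + c) * G) * unitResidueCosSum q x =
        b k + (b k - b (k + 1)) * (k - q * x) := by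
    intro k x h1 h2
    rw [unitResidueCosSum_interpolation hq2 k h1 h2, hb, hb, ← hG]
    field_simp
    ring
  have hphi : ∀ x : ℝ, |x| ≤ 1 / 2 →
      (∑' n : ℕ, a n * Real.cos (2 * π * n * x)) = phiPL p q b x := by
    intro x hx
    rw [(hsum x).tsum_eq]
    have habs : unitResidueCosSum q x = unitResidueCosSum q |x| := by
      rcases abs_choice x with h | h <;> rw [h]
      rw [unitResidueCosSum_neg hq0]
    have hx0 : 0 ≤ (q : ℝ) * |x| := by positivity
    rw [habs]
    unfold phiPL
    split_ifs with h
    · exact hcell _ _ (Nat.floor_le hx0) (Nat.lt_floor_add_one _).le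
    · rw [not_lt, div_le_iff₀ hqR] at h
      rw [hcell p |x| (by linarith) (by nlinarith), hb (p + 1), hbp, hcosp']
      simp
  have hmem : memK ((p : ℝ) / q) a := by
    refine ⟨hnonneg, hsum0.summable, hsum0.tsum_eq, fun x h1 h2 => ?_⟩
    rw [hphi x h2, phiPL, if_neg h1.not_gt]
  refine ⟨?_, hbp, ?_, a, hmem, hphi, ?_, ha0⟩
  · rw [hb]
    simp only [Nat.cast_zero, mul_zero, zero_div, Real.cos_zero]
    field_simp
    ring
  · rw [← ha0, ← integral_cosine_series hsum0.summable hnonneg]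
    refine intervalIntegral.integral_congr fun x hx => (hphi x ?_).symm
    rw [Set.uIcc_of_le (by norm_num)] at hx
    exact abs_le.2 hx
  · refine (IsGreatest.csSup_eq (s := {y : ℝ | ∃ a : ℕ → ℝ, memK ((p : ℝ) / q) a ∧ y = a 0})
      ⟨⟨a, hmem, rfl⟩, ?_⟩).symm
    rintro y ⟨a', ha', rfl⟩
    rw [ha0]
    exact memK_mean_le hp hq ha'
end
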